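/- arXiv:1007.2248 — 2 statements merged into one kernel-verified Lean document; each statement's English description precedes it below -/
import Mathlib

section
/- Let G be an m×n XOR game with no zero rows. Then there exist strictly positive real constants c_1,…,c_m such that a vector strategy {u_i},{v_j} of G is optimal if and only if ∑_{j=1}^n G_{ij} v_j = c_i u_i for all 1 ≤ i ≤ m; in particular c_i = ∑_j G_{ij} ⟨u_i, v_j⟩ for every optimal vector strategy. -/
open scoped BigOperators RealInnerProductSpace
open Matrix Kronecker

noncomputable section

/-- An XOR game is given by a cost matrix whose absolute entries sum to 1. -/
def isXORGame {ι κ : Type*} [Fintype ι] [Fintype κ] (G : Matrix ι κ ℝ) : Prop :=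
  ∑ i, ∑ j, |G i j| = 1

/-- The bias of a vector strategy. -/
def stratBias {ι κ : Type*} [Fintype ι] [Fintype κ] (G : Matrix ι κ ℝ) {N : ℕ}
    (u : ι → EuclideanSpace ℝ (Fin N)) (v : κ → EuclideanSpace ℝ (Fin N)) : ℝ :=
  ∑ i, ∑ j, G i j * ⟪u i, v j⟫

/-- The quantum bias of an XOR game: supremum of biases of vector strategies. -/
def quantumBias {ι κ : Type*} [Fintype ι] [Fintype κ] (G : Matrix ι κ ℝ) : ℝ :=
  sSup {b : ℝ | ∃ (N : ℕ) (u : ι → EuclideanSpace ℝ (Fin N))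
      (v : κ → EuclideanSpace ℝ (Fin N)),
    (∀ i, ‖u i‖ = 1) ∧ (∀ j, ‖v j‖ = 1) ∧ stratBias G u v = b}

/-- Objective function of the optimization problem (Γ). -/
def gammaObj {ι κ : Type*} [Fintype ι] [Fintype κ] (G : Matrix ι κ ℝ)
    (V : Matrix κ κ ℝ) : ℝ :=
  ∑ i, Real.sqrt (∑ j, ∑ k, G i j * G i k * V j k)

/-- `V` is an optimal solution of (Γ). -/
def gammaOptimal {ι κ : Type*} [Fintype ι] [Fintype κ] (G : Matrix ι κ ℝ)
    (V : Matrix κ κ ℝ) : Prop :=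
  V.PosSemidef ∧ (∀ j, V j j = 1) ∧
    ∀ W : Matrix κ κ ℝ, W.PosSemidef → (∀ j, W j j = 1) → gammaObj G W ≤ gammaObj G V

/-- `c` is the family of marginal row biases of `G`. -/
def isMarginalRowBiases {ι κ : Type*} [Fintype ι] [Fintype κ] (G : Matrix ι κ ℝ)
    (c : ι → ℝ) : Prop :=
  (∀ i, 0 ≤ c i) ∧
  ∀ (N : ℕ) (u : ι → EuclideanSpace ℝ (Fin N)) (v : κ → EuclideanSpace ℝ (Fin N)),
    (∀ i, ‖u i‖ = 1) → (∀ j, ‖v j‖ = 1) → stratBias G u v = quantumBias G →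
    ∀ i, ∑ j, G i j * ⟪u i, v j⟫ = c i

/-- `d` is the family of marginal column biases of `G`. -/
def isMarginalColBiases {ι κ : Type*} [Fintype ι] [Fintype κ] (G : Matrix ι κ ℝ)
    (d : κ → ℝ) : Prop :=
  (∀ j, 0 ≤ d j) ∧
  ∀ (N : ℕ) (u : ι → EuclideanSpace ℝ (Fin N)) (v : κ → EuclideanSpace ℝ (Fin N)),
    (∀ i, ‖u i‖ = 1) → (∀ j, ‖v j‖ = 1) → stratBias G u v = quantumBias G →
    ∀ j, ∑ i, G i j * ⟪u i, v j⟫ = d j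

/-- Hermitian inner product on `ι → ℂ`. -/
def cinner {ι : Type*} [Fintype ι] (x y : ι → ℂ) : ℂ := ∑ i, star (x i) * y i

/-- Hilbert space norm on `ι → ℂ`. -/
def cnorm {ι : Type*} [Fintype ι] (x : ι → ℂ) : ℝ := Real.sqrt (∑ i, ‖x i‖ ^ 2)

/-- Frobenius norm of a complex matrix. -/
def frobNorm {ι κ : Type*} [Fintype ι] [Fintype κ] (M : Matrix ι κ ℂ) : ℝ :=
  Real.sqrt (∑ i, ∑ j, ‖M i j‖ ^ 2)

/-- Operator norm of a complex square matrix. -/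
def opNorm {ι : Type*} [Fintype ι] [DecidableEq ι] (M : Matrix ι ι ℂ) : ℝ :=
  ‖Matrix.toEuclideanCLM (𝕜 := ℂ) M‖

/-- Bias of a quantum strategy. -/
def qStratBias {ι κ : Type*} [Fintype ι] [Fintype κ] {d₁ d₂ : ℕ} (G : Matrix ι κ ℝ)
    (A : ι → Matrix (Fin d₁) (Fin d₁) ℂ) (B : κ → Matrix (Fin d₂) (Fin d₂) ℂ)
    (ψ : Fin d₁ × Fin d₂ → ℂ) : ℂ :=
  ∑ i, ∑ j, (G i j : ℂ) * cinner ψ ((A i ⊗ₖ B j).mulVec ψ)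

/-- Nondegeneracy of a quantum strategy. -/
def Nondegenerate {ι κ : Type*} {d₁ d₂ : ℕ}
    (A : ι → Matrix (Fin d₁) (Fin d₁) ℂ) (B : κ → Matrix (Fin d₂) (Fin d₂) ℂ)
    (ψ : Fin d₁ × Fin d₂ → ℂ) : Prop :=
  (¬ ∃ P : Matrix (Fin d₁) (Fin d₁) ℂ, P ≠ 1 ∧ P.IsHermitian ∧ P * P = P ∧
      (∀ i, P * A i = A i * P) ∧ (P ⊗ₖ (1 : Matrix (Fin d₂) (Fin d₂) ℂ)).mulVec ψ = ψ) ∧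
  (¬ ∃ Q : Matrix (Fin d₂) (Fin d₂) ℂ, Q ≠ 1 ∧ Q.IsHermitian ∧ Q * Q = Q ∧
      (∀ j, Q * B j = B j * Q) ∧ ((1 : Matrix (Fin d₁) (Fin d₁) ℂ) ⊗ₖ Q).mulVec ψ = ψ)

section VectorStrategies

variable {ι κ : Type*} [Fintype κ]

/-- The `i`-th row of `G` applied to the family of vectors `v`. -/
def rowVector {E : Type*} [AddCommGroup E] [Module ℝ E] (G : Matrix ι κ ℝ) (v : κ → E)
    (i : ι) : E :=
  ∑ j, G i j • v j

lemma sum_mul_inner_eq_inner_rowVector {E : Type*} [NormedAddCommGroup E]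
    [InnerProductSpace ℝ E] (G : Matrix ι κ ℝ) (x : E) (v : κ → E) (i : ι) :
    ∑ j, G i j * ⟪x, v j⟫ = ⟪x, rowVector G v i⟫ := by
  simp [rowVector, inner_sum, real_inner_smul_right]

lemma LinearIsometry.map_rowVector {E F : Type*} [NormedAddCommGroup E] [InnerProductSpace ℝ E]
    [NormedAddCommGroup F] [InnerProductSpace ℝ F] (f : E →ₗᵢ[ℝ] F) (G : Matrix ι κ ℝ)
    (v : κ → E) (i : ι) : f (rowVector G v i) = rowVector G (fun j => f (v j)) i := by
  simp [rowVector]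

variable [Fintype ι]

lemma stratBias_eq_sum_inner_rowVector (G : Matrix ι κ ℝ) {N : ℕ}
    (u : ι → EuclideanSpace ℝ (Fin N)) (v : κ → EuclideanSpace ℝ (Fin N)) :
    stratBias G u v = ∑ i, ⟪u i, rowVector G v i⟫ := by
  simp [stratBias, sum_mul_inner_eq_inner_rowVector]

lemma bddAbove_stratBias (G : Matrix ι κ ℝ) :
    BddAbove {b : ℝ | ∃ (N : ℕ) (u : ι → EuclideanSpace ℝ (Fin N))
      (v : κ → EuclideanSpace ℝ (Fin N)),
      (∀ i, ‖u i‖ = 1) ∧ (∀ j, ‖v j‖ = 1) ∧ stratBias G u v = b} := by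
  refine ⟨∑ i, ∑ j, |G i j|, ?_⟩
  rintro b ⟨N, u, v, hu, hv, rfl⟩
  refine Finset.sum_le_sum fun i _ => Finset.sum_le_sum fun j _ => ?_
  have h := abs_real_inner_le_norm (u i) (v j)
  rw [hu, hv, mul_one] at h
  calc G i j * ⟪u i, v j⟫ ≤ |G i j| * |⟪u i, v j⟫| := by
        rw [← abs_mul]; exact le_abs_self _
    _ ≤ |G i j| := mul_le_of_le_one_right (abs_nonneg _) h

lemma sum_inner_rowVector_le_quantumBias {E : Type*} [NormedAddCommGroup E]
    [InnerProductSpace ℝ E] [FiniteDimensional ℝ E] (G : Matrix ι κ ℝ) (u : ι → E) (v : κ → E)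
    (hu : ∀ i, ‖u i‖ = 1) (hv : ∀ j, ‖v j‖ = 1) :
    ∑ i, ⟪u i, rowVector G v i⟫ ≤ quantumBias G := by
  let f := (stdOrthonormalBasis ℝ E).repr.toLinearIsometry
  refine le_csSup (bddAbove_stratBias G) ⟨_, fun i => f (u i), fun j => f (v j),
    fun i => by rw [f.norm_map, hu], fun j => by rw [f.norm_map, hv], ?_⟩
  simp [stratBias_eq_sum_inner_rowVector, ← f.map_rowVector]

lemma sum_norm_rowVector_le_quantumBias {E : Type*} [NormedAddCommGroup E]
    [InnerProductSpace ℝ E] [FiniteDimensional ℝ E] [Nontrivial E] (G : Matrix ι κ ℝ) (v : κ → E)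
    (hv : ∀ j, ‖v j‖ = 1) : ∑ i, ‖rowVector G v i‖ ≤ quantumBias G := by
  obtain ⟨e, he⟩ := exists_norm_eq E zero_le_one
  have hex (w : E) : ∃ x : E, ‖x‖ = 1 ∧ ⟪x, w⟫ = ‖w‖ := by
    by_cases hw : w = 0
    · exact ⟨e, he, by simp [hw]⟩
    · have hw' : ‖w‖ ≠ 0 := norm_ne_zero_iff.mpr hw
      refine ⟨‖w‖⁻¹ • w, by simp [norm_smul, hw'], ?_⟩
      rw [real_inner_smul_left, real_inner_self_eq_norm_sq]
      field_simp
  choose u hu huw using fun i => hex (rowVector G v i)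
  simpa [huw] using sum_inner_rowVector_le_quantumBias G u v hu hv

lemma sum_sqrt_norm_rowVector_le_quantumBias {E F : Type*} [NormedAddCommGroup E]
    [InnerProductSpace ℝ E] [FiniteDimensional ℝ E] [Nontrivial E] [NormedAddCommGroup F]
    [InnerProductSpace ℝ F] [FiniteDimensional ℝ F] (G : Matrix ι κ ℝ)
    (v : κ → E) (w : κ → F) (hv : ∀ j, ‖v j‖ = 1) (hw : ∀ j, ‖w j‖ = 1) {x y : ℝ}
    (hxy : x ^ 2 + y ^ 2 = 1) :
    ∑ i, √(x ^ 2 * ‖rowVector G v i‖ ^ 2 + y ^ 2 * ‖rowVector G w i‖ ^ 2) ≤ quantumBias G := by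
  let z : κ → WithLp 2 (E × F) := fun j => WithLp.toLp 2 (x • v j, y • w j)
  have hnorm (a : E) (b : F) :
      ‖WithLp.toLp 2 (x • a, y • b)‖ = √(x ^ 2 * ‖a‖ ^ 2 + y ^ 2 * ‖b‖ ^ 2) := by
    simp [WithLp.prod_norm_eq_of_L2, norm_smul, mul_pow]
  have hz (j : κ) : ‖z j‖ = 1 := by simp [z, hnorm, hv, hw, hxy]
  have hrow (i : ι) :
      rowVector G z i = WithLp.toLp 2 (x • rowVector G v i, y • rowVector G w i) := by
    apply (WithLp.linearEquiv 2 ℝ (E × F)).injective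
    ext <;> simp [rowVector, z, Finset.smul_sum, Prod.fst_sum, Prod.snd_sum, smul_comm x, smul_comm y]
  have : Nontrivial (WithLp 2 (E × F)) := (WithLp.equiv 2 (E × F)).nontrivial
  simpa [hrow, hnorm] using sum_norm_rowVector_le_quantumBias G z hz

lemma exists_linearIsometry_of_finrank_le {E : Type*} [NormedAddCommGroup E]
    [InnerProductSpace ℝ E] [FiniteDimensional ℝ E] {d : ℕ} (h : Module.finrank ℝ E ≤ d) :
    Nonempty (E →ₗᵢ[ℝ] EuclideanSpace ℝ (Fin d)) := by
  let b := stdOrthonormalBasis ℝ E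
  let f := b.toBasis.constr ℝ fun i => EuclideanSpace.basisFun (Fin d) ℝ (Fin.castLE h i)
  refine ⟨f.isometryOfOrthonormal (v := b.toBasis) (by simp) ?_⟩
  have hf : f ∘ b.toBasis = EuclideanSpace.basisFun (Fin d) ℝ ∘ Fin.castLE h := by
    ext1 i
    exact b.toBasis.constr_basis ℝ _ i
  rw [hf]
  exact (EuclideanSpace.basisFun (Fin d) ℝ).orthonormal.comp _ (Fin.castLE_injective h)

lemma exists_stratBias_eq_of_card (G : Matrix ι κ ℝ) {N : ℕ}
    (u : ι → EuclideanSpace ℝ (Fin N)) (v : κ → EuclideanSpace ℝ (Fin N))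
    (hu : ∀ i, ‖u i‖ = 1) (hv : ∀ j, ‖v j‖ = 1) :
    ∃ (u' : ι → EuclideanSpace ℝ (Fin (Fintype.card (ι ⊕ κ))))
      (v' : κ → EuclideanSpace ℝ (Fin (Fintype.card (ι ⊕ κ)))),
      (∀ i, ‖u' i‖ = 1) ∧ (∀ j, ‖v' j‖ = 1) ∧ stratBias G u' v' = stratBias G u v := by
  let S := Submodule.span ℝ (Set.range (Sum.elim u v))
  obtain ⟨f⟩ := exists_linearIsometry_of_finrank_le (E := S) (finrank_range_le_card (R := ℝ) _)
  have hmem (k : ι ⊕ κ) : Sum.elim u v k ∈ S := Submodule.subset_span ⟨k, rfl⟩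
  refine ⟨fun i => f ⟨u i, hmem (.inl i)⟩, fun j => f ⟨v j, hmem (.inr j)⟩,
    fun i => by simp [hu], fun j => by simp [hv], by simp [stratBias]⟩

lemma exists_stratBias_eq_quantumBias [Nonempty (ι ⊕ κ)] (G : Matrix ι κ ℝ) :
    ∃ (N : ℕ) (u : ι → EuclideanSpace ℝ (Fin N)) (v : κ → EuclideanSpace ℝ (Fin N)),
      (∀ i, ‖u i‖ = 1) ∧ (∀ j, ‖v j‖ = 1) ∧ stratBias G u v = quantumBias G := by
  let N := Fintype.card (ι ⊕ κ)
  let E := EuclideanSpace ℝ (Fin N)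
  have : Nonempty (Fin N) := Fin.pos_iff_nonempty.mp Fintype.card_pos
  obtain ⟨e, he⟩ := exists_norm_eq E zero_le_one
  let K : Set ((ι → E) × (κ → E)) :=
    (Set.univ.pi fun _ => Metric.sphere 0 1) ×ˢ (Set.univ.pi fun _ => Metric.sphere 0 1)
  have hK : IsCompact K :=
    (isCompact_univ_pi fun _ => isCompact_sphere 0 1).prod
      (isCompact_univ_pi fun _ => isCompact_sphere 0 1)
  have hmem (p : (ι → E) × (κ → E)) : p ∈ K ↔ (∀ i, ‖p.1 i‖ = 1) ∧ ∀ j, ‖p.2 j‖ = 1 := by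
    simp [K, Set.mem_prod, Set.mem_pi]
  have hne : K.Nonempty := ⟨(fun _ => e, fun _ => e), by simp [hmem, he]⟩
  have hcont : Continuous fun p : (ι → E) × (κ → E) => stratBias G p.1 p.2 := by
    unfold stratBias
    fun_prop
  obtain ⟨⟨u, v⟩, huv, hmax⟩ := hK.exists_isMaxOn hne hcont.continuousOn
  obtain ⟨hu, hv⟩ := (hmem _).mp huv
  refine ⟨N, u, v, hu, hv, le_antisymm
    (le_csSup (bddAbove_stratBias G) ⟨N, u, v, hu, hv, rfl⟩)
    (csSup_le ⟨_, N, u, v, hu, hv, rfl⟩ ?_)⟩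
  rintro b ⟨M, u', v', hu', hv', rfl⟩
  obtain ⟨u'', v'', hu'', hv'', h⟩ := exists_stratBias_eq_of_card G u' v' hu' hv'
  rw [← h]
  exact hmax (a := (u'', v'')) ((hmem _).mpr ⟨hu'', hv''⟩)

variable {N : ℕ} [Nontrivial (EuclideanSpace ℝ (Fin N))] {G : Matrix ι κ ℝ}
  {u : ι → EuclideanSpace ℝ (Fin N)} {v : κ → EuclideanSpace ℝ (Fin N)}

lemma inner_rowVector_eq_norm_of_optimal (hu : ∀ i, ‖u i‖ = 1) (hv : ∀ j, ‖v j‖ = 1)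
    (h : stratBias G u v = quantumBias G) (i : ι) :
    ⟪u i, rowVector G v i⟫ = ‖rowVector G v i‖ := by
  have hle (i : ι) : ⟪u i, rowVector G v i⟫ ≤ ‖rowVector G v i‖ := by
    simpa [hu] using real_inner_le_norm (u i) (rowVector G v i)
  have hsum : ∑ i, ⟪u i, rowVector G v i⟫ = ∑ i, ‖rowVector G v i‖ := by
    refine le_antisymm (Finset.sum_le_sum fun i _ => hle i) ?_
    rw [← stratBias_eq_sum_inner_rowVector, h]
    exact sum_norm_rowVector_le_quantumBias G v hv
  exact (Finset.sum_eq_sum_iff_of_le fun i _ => hle i).mp hsum i (Finset.mem_univ i)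

lemma rowVector_eq_norm_smul_of_optimal (hu : ∀ i, ‖u i‖ = 1) (hv : ∀ j, ‖v j‖ = 1)
    (h : stratBias G u v = quantumBias G) (i : ι) :
    rowVector G v i = ‖rowVector G v i‖ • u i := by
  have := inner_eq_norm_mul_iff_real (x := u i) (y := rowVector G v i)
  rw [hu, one_mul, one_smul] at this
  exact (this.mp (inner_rowVector_eq_norm_of_optimal hu hv h i)).symm

lemma sum_norm_rowVector_of_optimal (hu : ∀ i, ‖u i‖ = 1) (hv : ∀ j, ‖v j‖ = 1)
    (h : stratBias G u v = quantumBias G) : ∑ i, ‖rowVector G v i‖ = quantumBias G := by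
  simp [← h, stratBias_eq_sum_inner_rowVector, inner_rowVector_eq_norm_of_optimal hu hv h]

lemma norm_rowVector_eq_of_optimal {M : ℕ} [Nontrivial (EuclideanSpace ℝ (Fin M))]
    {u' : ι → EuclideanSpace ℝ (Fin M)} {v' : κ → EuclideanSpace ℝ (Fin M)}
    (hu : ∀ i, ‖u i‖ = 1) (hv : ∀ j, ‖v j‖ = 1) (h : stratBias G u v = quantumBias G)
    (hu' : ∀ i, ‖u' i‖ = 1) (hv' : ∀ j, ‖v' j‖ = 1) (h' : stratBias G u' v' = quantumBias G)
    (i : ι) : ‖rowVector G v i‖ = ‖rowVector G v' i‖ := by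
  set a := fun i => ‖rowVector G v i‖
  set b := fun i => ‖rowVector G v' i‖
  have hhalf : (√(1 / 2)) ^ 2 = (1 / 2 : ℝ) := Real.sq_sqrt (by norm_num)
  have hmix : ∑ i, √(1 / 2 * a i ^ 2 + 1 / 2 * b i ^ 2) ≤ quantumBias G := by
    have := sum_sqrt_norm_rowVector_le_quantumBias G v v' hv hv' (x := √(1 / 2))
      (y := √(1 / 2)) (by rw [hhalf]; norm_num)
    rwa [hhalf] at this
  have hle (i : ι) : (a i + b i) / 2 ≤ √(1 / 2 * a i ^ 2 + 1 / 2 * b i ^ 2) :=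
    Real.le_sqrt_of_sq_le (by nlinarith [sq_nonneg (a i - b i)])
  have hsum : ∑ i, (a i + b i) / 2 = quantumBias G := by
    rw [← Finset.sum_div, Finset.sum_add_distrib, sum_norm_rowVector_of_optimal hu hv h,
      sum_norm_rowVector_of_optimal hu' hv' h', add_self_div_two]
  have heq := (Finset.sum_eq_sum_iff_of_le fun i _ => hle i).mp
    (le_antisymm (Finset.sum_le_sum fun i _ => hle i) (hmix.trans_eq hsum.symm)) i
    (Finset.mem_univ i)
  have hsq := Real.sq_sqrt (show 0 ≤ 1 / 2 * a i ^ 2 + 1 / 2 * b i ^ 2 by positivity)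
  rw [← heq] at hsq
  have : (a i - b i) ^ 2 = 0 := by linarith
  exact sub_eq_zero.mp (pow_eq_zero_iff two_ne_zero |>.mp this)

lemma norm_rowVector_pos_of_optimal (hu : ∀ i, ‖u i‖ = 1) (hv : ∀ j, ‖v j‖ = 1)
    (h : stratBias G u v = quantumBias G) {i₀ : ι} (hrow : ∃ j, G i₀ j ≠ 0) :
    0 < ‖rowVector G v i₀‖ := by
  by_contra hneg
  have hzero : ‖rowVector G v i₀‖ = 0 := le_antisymm (not_lt.mp hneg) (norm_nonneg _)
  let s : κ → ℝ := fun j => if 0 ≤ G i₀ j then 1 else -1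
  have hs (j : κ) : ‖s j‖ = 1 := by
    by_cases hj : 0 ≤ G i₀ j <;> simp [s, hj]
  set a := ‖rowVector G s i₀‖
  have ha : 0 < a := by
    have hrs : rowVector G s i₀ = ∑ j, |G i₀ j| := by
      refine Finset.sum_congr rfl fun j _ => ?_
      by_cases hj : 0 ≤ G i₀ j
      · simp [s, hj, abs_of_nonneg hj]
      · simp [s, hj, abs_of_neg (not_le.mp hj)]
    obtain ⟨j, hj⟩ := hrow
    have hpos : 0 < ∑ j, |G i₀ j| :=
      Finset.sum_pos' (fun j _ => abs_nonneg _) ⟨j, Finset.mem_univ j, abs_pos.mpr hj⟩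
    rw [norm_pos_iff, hrs]
    exact hpos.ne'
  set q := quantumBias G
  have hq : ∑ i, ‖rowVector G v i‖ = q := sum_norm_rowVector_of_optimal hu hv h
  have hq0 : 0 ≤ q := hq ▸ Finset.sum_nonneg fun i _ => norm_nonneg _
  set r := √(q ^ 2 + a ^ 2)
  have hr2 : r ^ 2 = q ^ 2 + a ^ 2 := Real.sq_sqrt (by positivity)
  have hr : 0 < r := Real.sqrt_pos.mpr (by positivity)
  have hmix := sum_sqrt_norm_rowVector_le_quantumBias G v s hv hs (x := q / r) (y := a / r)
    (by field_simp; exact hr2.symm)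
  classical
  have hle (i : ι) : q / r * ‖rowVector G v i‖ + (if i = i₀ then a / r * a else 0) ≤
      √((q / r) ^ 2 * ‖rowVector G v i‖ ^ 2 + (a / r) ^ 2 * ‖rowVector G s i‖ ^ 2) := by
    apply Real.le_sqrt_of_sq_le
    split_ifs with hi
    · subst hi
      rw [hzero]
      exact le_of_eq (by ring)
    · have : 0 ≤ (a / r) ^ 2 * ‖rowVector G s i‖ ^ 2 := by positivity
      linarith [mul_pow (q / r) ‖rowVector G v i‖ 2]
  have hsum := (Finset.sum_le_sum fun i (_ : i ∈ Finset.univ) => hle i).trans hmix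
  rw [Finset.sum_add_distrib, ← Finset.mul_sum, hq, Finset.sum_ite_eq' Finset.univ i₀,
    if_pos (Finset.mem_univ i₀)] at hsum
  have hrq : r ≤ q := by
    have : q / r * q + a / r * a = r := by
      field_simp
      linarith
    linarith
  nlinarith

end VectorStrategies

/-- for an XOR game `G` with no zero rows there are strictly
positive constants `c i` such that a vector strategy is optimal iff
`∑ j G i j • v j = c i • u i` for all `i`; in particular
`c i = ∑ j G i j ⟪u i, v j⟫` for every optimal vector strategy. -/
theorem optimal_vector_strategies_characterization {m n : ℕ}
    (G : Matrix (Fin m) (Fin n) ℝ) (hG : isXORGame G)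
    (hrows : ∀ i, ∃ j, G i j ≠ 0) :
    ∃ c : Fin m → ℝ,
      (∀ i, 0 < c i) ∧
      (∀ (N : ℕ) (u : Fin m → EuclideanSpace ℝ (Fin N))
        (v : Fin n → EuclideanSpace ℝ (Fin N)),
        (∀ i, ‖u i‖ = 1) → (∀ j, ‖v j‖ = 1) →
        (stratBias G u v = quantumBias G ↔ ∀ i, (∑ j, G i j • v j) = c i • u i)) ∧
      (∀ (N : ℕ) (u : Fin m → EuclideanSpace ℝ (Fin N))
        (v : Fin n → EuclideanSpace ℝ (Fin N)),
        (∀ i, ‖u i‖ = 1) → (∀ j, ‖v j‖ = 1) →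
        stratBias G u v = quantumBias G →
        ∀ i, ∑ j, G i j * ⟪u i, v j⟫ = c i) := by
  have hm : Nonempty (Fin m) := by
    by_contra hm
    rw [not_nonempty_iff] at hm
    simp [isXORGame] at hG
  have hnontriv {N : ℕ} (u : Fin m → EuclideanSpace ℝ (Fin N)) (hu : ∀ i, ‖u i‖ = 1) :
      Nontrivial (EuclideanSpace ℝ (Fin N)) :=
    ⟨u hm.some, 0, norm_ne_zero_iff.mp (by simp [hu])⟩
  obtain ⟨N₀, u₀, v₀, hu₀, hv₀, h₀⟩ := exists_stratBias_eq_quantumBias G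
  have := hnontriv u₀ hu₀
  refine ⟨fun i => ‖rowVector G v₀ i‖,
    fun i => norm_rowVector_pos_of_optimal hu₀ hv₀ h₀ (hrows i), ?_, ?_⟩
  · intro N u v hu hv
    have := hnontriv u hu
    refine ⟨fun h i => ?_, fun h => ?_⟩
    · beta_reduce
      rw [norm_rowVector_eq_of_optimal hu₀ hv₀ h₀ hu hv h i]
      exact rowVector_eq_norm_smul_of_optimal hu hv h i
    · rw [stratBias_eq_sum_inner_rowVector, ← sum_norm_rowVector_of_optimal hu₀ hv₀ h₀]
      refine Finset.sum_congr rfl fun i _ => ?_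
      rw [show rowVector G v i = _ from h i, real_inner_smul_right, real_inner_self_eq_norm_sq,
        hu, one_pow, mul_one]
  · intro N u v hu hv h i
    have := hnontriv u hu
    rw [sum_mul_inner_eq_inner_rowVector, inner_rowVector_eq_norm_of_optimal hu hv h i]
    exact (norm_rowVector_eq_of_optimal hu₀ hv₀ h₀ hu hv h i).symm
end
end

section
/- For every m×n XOR game G, the quantum bias ε_q(G) equals the optimum value of (Γ); that is, the supremum over all vector strategies {u_i},{v_j} of ∑_{i,j} G_{ij} ⟨u_i, v_j⟩ equals the maximum of ∑_{i=1}^m sqrt(∑_{j,k=1}^n G_{ij} G_{ik} V_{jk}) over real positive semidefinite n×n matrices V with unit diagonal. -/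
open scoped BigOperators RealInnerProductSpace
open Matrix Kronecker

noncomputable section

lemma gammaObj_gram {ι κ E : Type*} [Fintype ι] [Fintype κ] [NormedAddCommGroup E]
    [InnerProductSpace ℝ E] (G : Matrix ι κ ℝ) (v : κ → E) :
    gammaObj G (Matrix.gram ℝ v) = ∑ i, ‖∑ j, G i j • v j‖ := by
  unfold gammaObj
  refine Finset.sum_congr rfl fun i _ => ?_
  rw [norm_eq_sqrt_real_inner, sum_inner]
  simp only [inner_sum, real_inner_smul_left, real_inner_smul_right, Matrix.gram_apply, mul_assoc,
    mul_left_comm]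

lemma exists_gram_eq_of_posSemidef {n : ℕ} {V : Matrix (Fin n) (Fin n) ℝ} (hV : V.PosSemidef) :
    ∃ v : Fin n → EuclideanSpace ℝ (Fin n), Matrix.gram ℝ v = V := by
  obtain ⟨B, rfl⟩ : ∃ B : Matrix (Fin n) (Fin n) ℝ, V = Bᴴ * B := by
    open scoped MatrixOrder ComplexOrder in
    exact CStarAlgebra.nonneg_iff_eq_star_mul_self.mp hV.nonneg
  refine ⟨fun j => WithLp.toLp 2 fun k => B k j, ?_⟩
  ext i j
  simp [Matrix.gram_apply, Matrix.mul_apply, PiLp.inner_apply, mul_comm]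

lemma stratBias_eq_sum_inner {ι κ : Type*} [Fintype ι] [Fintype κ] (G : Matrix ι κ ℝ) {N : ℕ}
    (u : ι → EuclideanSpace ℝ (Fin N)) (v : κ → EuclideanSpace ℝ (Fin N)) :
    stratBias G u v = ∑ i, ⟪u i, ∑ j, G i j • v j⟫ := by
  simp only [stratBias, inner_sum, real_inner_smul_right]

lemma stratBias_le_gammaObj_gram {ι κ : Type*} [Fintype ι] [Fintype κ] (G : Matrix ι κ ℝ)
    {N : ℕ} {u : ι → EuclideanSpace ℝ (Fin N)} (hu : ∀ i, ‖u i‖ = 1)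
    (v : κ → EuclideanSpace ℝ (Fin N)) :
    stratBias G u v ≤ gammaObj G (Matrix.gram ℝ v) := by
  rw [stratBias_eq_sum_inner, gammaObj_gram]
  refine Finset.sum_le_sum fun i _ => ?_
  simpa [hu i] using real_inner_le_norm (u i) (∑ j, G i j • v j)

lemma exists_norm_eq_one_inner_eq_norm {E : Type*} [NormedAddCommGroup E]
    [InnerProductSpace ℝ E] [Nontrivial E] (w : E) : ∃ u : E, ‖u‖ = 1 ∧ ⟪u, w⟫ = ‖w‖ := by
  rcases eq_or_ne w 0 with rfl | hw
  · obtain ⟨u, hu⟩ := exists_norm_eq E zero_le_one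
    exact ⟨u, hu, by simp⟩
  · have hw' : ‖w‖ ≠ 0 := norm_ne_zero_iff.mpr hw
    refine ⟨‖w‖⁻¹ • w, by rw [norm_smul, norm_inv, norm_norm, inv_mul_cancel₀ hw'], ?_⟩
    rw [real_inner_smul_left, real_inner_self_eq_norm_sq]
    field_simp

lemma exists_stratBias_eq_gammaObj_gram {ι κ : Type*} [Fintype ι] [Fintype κ]
    (G : Matrix ι κ ℝ) {N : ℕ} [NeZero N] (v : κ → EuclideanSpace ℝ (Fin N)) :
    ∃ u : ι → EuclideanSpace ℝ (Fin N),
      (∀ i, ‖u i‖ = 1) ∧ stratBias G u v = gammaObj G (Matrix.gram ℝ v) := by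
  choose u hu hinner using fun i => exists_norm_eq_one_inner_eq_norm (∑ j, G i j • v j)
  exact ⟨u, hu, by simp only [stratBias_eq_sum_inner, gammaObj_gram, hinner]⟩

lemma gram_apply_self_eq_one_iff {κ E : Type*} [NormedAddCommGroup E] [InnerProductSpace ℝ E]
    (v : κ → E) (j : κ) : Matrix.gram ℝ v j j = 1 ↔ ‖v j‖ = 1 := by
  rw [Matrix.gram_apply, real_inner_self_eq_norm_sq, pow_eq_one_iff_of_nonneg (norm_nonneg _) two_ne_zero]

lemma exists_gammaOptimal {n : ℕ} [NeZero n] {ι : Type*} [Fintype ι] (G : Matrix ι (Fin n) ℝ) :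
    ∃ v : Fin n → EuclideanSpace ℝ (Fin n),
      (∀ j, ‖v j‖ = 1) ∧ gammaOptimal G (Matrix.gram ℝ v) := by
  have hcompact : IsCompact (Set.univ.pi fun _ : Fin n =>
      Metric.sphere (0 : EuclideanSpace ℝ (Fin n)) 1) :=
    isCompact_univ_pi fun _ => isCompact_sphere _ _
  have hnonempty : (Set.univ.pi fun _ : Fin n =>
      Metric.sphere (0 : EuclideanSpace ℝ (Fin n)) 1).Nonempty :=
    Set.univ_pi_nonempty_iff.mpr fun _ => NormedSpace.sphere_nonempty.mpr zero_le_one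
  obtain ⟨v, hv, hmax⟩ := hcompact.exists_isMaxOn hnonempty
    (f := fun v => ∑ i, ‖∑ j, G i j • v j‖) (by fun_prop)
  have hv' : ∀ j, ‖v j‖ = 1 := by simpa using hv
  refine ⟨v, hv', Matrix.posSemidef_gram ℝ v,
    fun j => (gram_apply_self_eq_one_iff v j).mpr (hv' j), fun W hW hW1 => ?_⟩
  obtain ⟨w, rfl⟩ := exists_gram_eq_of_posSemidef hW
  rw [gammaObj_gram, gammaObj_gram]
  simp only [gram_apply_self_eq_one_iff] at hW1
  exact hmax (by simpa using hW1)

/-- the quantum bias of an XOR game equals the maximum of the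
optimization problem (Γ): it is the greatest value of the (Γ)-objective over
positive semidefinite matrices with unit diagonal. -/
theorem quantumBias_eq_gamma_optimum {m n : ℕ} (G : Matrix (Fin m) (Fin n) ℝ)
    (hG : isXORGame G) :
    IsGreatest {x : ℝ | ∃ V : Matrix (Fin n) (Fin n) ℝ,
        V.PosSemidef ∧ (∀ j, V j j = 1) ∧ gammaObj G V = x}
      (quantumBias G) := by
  have : NeZero n := ⟨by rintro rfl; simp [isXORGame] at hG⟩
  obtain ⟨v, hv, hV, hdiag, hmax⟩ := exists_gammaOptimal G
  have hbias : quantumBias G = gammaObj G (Matrix.gram ℝ v) := by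
    obtain ⟨u, hu, huv⟩ := exists_stratBias_eq_gammaObj_gram G v
    refine IsGreatest.csSup_eq ⟨⟨n, u, v, hu, hv, huv⟩, ?_⟩
    rintro _ ⟨N, u', v', hu', hv', rfl⟩
    exact (stratBias_le_gammaObj_gram G hu' v').trans <| hmax _ (Matrix.posSemidef_gram ℝ v')
      fun j => (gram_apply_self_eq_one_iff v' j).mpr (hv' j)
  rw [hbias]
  refine ⟨⟨_, hV, hdiag, rfl⟩, ?_⟩
  rintro _ ⟨W, hW, hW1, rfl⟩
  exact hmax W hW hW1
end
end
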